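/- If m ∈ G(I^k), s ∈ set(m), x_s·m/x_{min(m)} ≻ v^k (strictly), and t ∈ set(x_s·m/x_{min(m)}), then t ∈ set(m); that is, set(x_s·m/x_{min(m)}) ⊆ set(m). -/

import Mathlib

open MvPolynomial Finset

/-- A monomial in `n` variables, recorded by its exponent vector
(index `i : Fin n` corresponds to the variable `x_{i+1}` of the paper). -/
abbrev Mon (n : ℕ) := Fin n →₀ ℕ

/-- The exponent vector of the single variable `x_{j+1}` (`0`-indexed `j`). -/
noncomputable def sing (n j : ℕ) : Mon n :=
  Finsupp.onFinset Finset.univ (fun i => if (i : ℕ) = j then 1 else 0)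
    (fun a _ => Finset.mem_univ a)

/-- Total degree of a monomial. -/
def deg {n : ℕ} (m : Mon n) : ℕ := m.sum fun _ e => e

/-- `m₁ <_lex m₂` for the lexicographic order with `x_1 > x_2 > ⋯ > x_n`. -/
def lexLT {n : ℕ} (m₁ m₂ : Mon n) : Prop :=
  ∃ i : Fin n, (∀ j : Fin n, j < i → m₁ j = m₂ j) ∧ m₁ i < m₂ i

def lexLE {n : ℕ} (m₁ m₂ : Mon n) : Prop := m₁ = m₂ ∨ lexLT m₁ m₂

/-- `m₁ <_revlex m₂` : the increasing reverse lexicographic order. -/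
def revLT {n : ℕ} (m₁ m₂ : Mon n) : Prop :=
  ∃ s : Fin n, (∀ i : Fin n, s < i → m₁ i = m₂ i) ∧ m₂ s < m₁ s

def revLE {n : ℕ} (m₁ m₂ : Mon n) : Prop := m₁ = m₂ ∨ revLT m₁ m₂

/-- `min(m)`: the (0-indexed) smallest index in the support of `m`. -/
noncomputable def minIdx {n : ℕ} (m : Mon n) : ℕ := sInf {j : ℕ | ∃ h : j < n, m ⟨j, h⟩ ≠ 0}

/-- `m̄`: the part of `m` supported in the variables `x_1, …, x_l`
(0-indexed: indices `< l`). -/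
noncomputable def lowPart {n : ℕ} (l : ℕ) (m : Mon n) : Mon n :=
  m.filter fun i => (i : ℕ) < l

/-- `m̃`: the part of `m` supported in the variables `x_{l+1}, …, x_n`
(0-indexed: indices `≥ l`). -/
noncomputable def highPart {n : ℕ} (l : ℕ) (m : Mon n) : Mon n :=
  m.filter fun i => l ≤ (i : ℕ)

/-- The exponent vector of `u = x_1 · x_{l+1}^{a_{l+1}} ⋯ x_n^{a_n}`, where
`a j` (for `l ≤ j < n`, 0-indexed) is the exponent of `x_{j+1}`. -/
noncomputable def uVec (n l : ℕ) (a : ℕ → ℕ) : Mon n :=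
  sing n 0 + ∑ j ∈ Finset.Ico l n, a j • sing n j

/-- The exponent vector of `v = x_l · x_n^{d-1}`. -/
noncomputable def vVec (n l d : ℕ) : Mon n :=
  sing n (l - 1) + (d - 1) • sing n (n - 1)

/-- The lexsegment `L(u,v)`: monomials `w` of degree `d` with `u ≥_lex w ≥_lex v`. -/
def lexSeg (n l d : ℕ) (a : ℕ → ℕ) : Set (Mon n) :=
  { w | deg w = d ∧ lexLE (vVec n l d) w ∧ lexLE w (uVec n l a) }

/-- The lexsegment ideal `I = (L(u,v)) ⊆ K[x_1,…,x_n]`. -/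
noncomputable def lexIdeal (n l d : ℕ) (a : ℕ → ℕ) (K : Type*) [Field K] :
    Ideal (MvPolynomial (Fin n) K) :=
  Ideal.span ((fun w => monomial w (1 : K)) '' lexSeg n l d a)

/-- `G(J)`: the minimal monomial generators of a monomial ideal `J`, i.e.
monomials `m ∈ J` with `m / x_i ∉ J` for every `i ∈ supp m`. -/
def minGens {n : ℕ} (K : Type*) [Field K] (J : Ideal (MvPolynomial (Fin n) K)) :
    Set (Mon n) :=
  { m | monomial m (1 : K) ∈ J ∧
      ∀ i ∈ m.support, monomial (m - Finsupp.single i 1) (1 : K) ∉ J }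

/-- `J_{<revlex m}`: the ideal generated by all `z ∈ G(J)` with `z <_revlex m`. -/
noncomputable def idealBelow {n : ℕ} (K : Type*) [Field K]
    (J : Ideal (MvPolynomial (Fin n) K)) (m : Mon n) : Ideal (MvPolynomial (Fin n) K) :=
  Ideal.span ((fun z => monomial z (1 : K)) '' { z | z ∈ minGens K J ∧ revLT z m })

/-- `set(m) = {j : x_j · m ∈ J_{<revlex m}}` (0-indexed). -/
def setOfGen {n : ℕ} (K : Type*) [Field K] (J : Ideal (MvPolynomial (Fin n) K))
    (m : Mon n) : Set ℕ :=
  { j | j < n ∧ monomial (m + sing n j) (1 : K) ∈ idealBelow K J m }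

/-- The order `≺` on monomials: compare first the degree of the part supported in
`x_1,…,x_l`, then `<_lex`. -/
def precLT {n : ℕ} (l : ℕ) (m₁ m₂ : Mon n) : Prop :=
  deg (lowPart l m₁) < deg (lowPart l m₂) ∨
    (deg (lowPart l m₁) = deg (lowPart l m₂) ∧ lexLT m₁ m₂)

/-- `w = g(z)`: `w` is the `<_revlex`-smallest minimal monomial generator of `J`
dividing the monomial `z` (the value of the decomposition function). -/
def isDecompOf {n : ℕ} (K : Type*) [Field K] (J : Ideal (MvPolynomial (Fin n) K))
    (z w : Mon n) : Prop :=
  w ∈ minGens K J ∧ w ≤ z ∧ ∀ w' ∈ minGens K J, w' ≤ z → revLE w w'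

namespace S13

def lo {n : ℕ} (l : ℕ) (m : Mon n) : ℕ := ∑ i : Fin n, if (i : ℕ) < l then m i else 0

lemma deg_eq {n : ℕ} (m : Mon n) : deg m = ∑ i : Fin n, m i := by
  unfold deg
  exact Finsupp.sum_fintype _ _ (fun _ => rfl)

lemma lowPart_eq {n : ℕ} (l : ℕ) (m : Mon n) : deg (lowPart l m) = lo l m := by
  rw [deg_eq]
  unfold lowPart lo
  simp [Finsupp.filter_apply]

lemma deg_add {n : ℕ} (p q : Mon n) : deg (p + q) = deg p + deg q := by
  simp [deg_eq, Finset.sum_add_distrib]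

lemma deg_single {n : ℕ} (i : Fin n) : deg (Finsupp.single i 1 : Mon n) = 1 := by
  simp [deg_eq, Finsupp.single_apply]

lemma lo_add {n : ℕ} (l : ℕ) (p q : Mon n) : lo l (p + q) = lo l p + lo l q := by
  unfold lo
  rw [← Finset.sum_add_distrib]
  refine Finset.sum_congr rfl fun i _ => ?_
  split_ifs <;> simp

lemma lo_single {n : ℕ} (l : ℕ) (i : Fin n) :
    lo l (Finsupp.single i 1 : Mon n) = if (i : ℕ) < l then 1 else 0 := by
  unfold lo
  rw [Finset.sum_eq_single i]
  · simp
  · intro b _ hb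
    simp [Finsupp.single_apply, hb.symm]
  · simp

lemma le_lo {n : ℕ} (l : ℕ) (m : Mon n) (i : Fin n) (hi : (i : ℕ) < l) : m i ≤ lo l m := by
  have := Finset.single_le_sum (f := fun i : Fin n => if (i : ℕ) < l then m i else 0)
    (fun _ _ => Nat.zero_le _) (Finset.mem_univ i)
  simpa [hi, lo] using this

lemma exists_of_lo {n : ℕ} (l : ℕ) (m : Mon n) (h : 1 ≤ lo l m) :
    ∃ i : Fin n, (i : ℕ) < l ∧ m i ≠ 0 := by
  by_contra hc
  push Not at hc
  have : lo l m = 0 := Finset.sum_eq_zero fun i _ => by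
    split_ifs with h
    · exact hc i h
    · rfl
  omega

lemma sing_eq {n : ℕ} (i : Fin n) : sing n i = Finsupp.single i 1 := by
  ext j
  simp [sing, Finsupp.single_apply, Fin.ext_iff, eq_comm]

/-- splitting off a variable -/
lemma exists_split {n : ℕ} (f : Mon n) (i : Fin n) (h : f i ≠ 0) :
    ∃ r : Mon n, f = r + Finsupp.single i 1 := by
  refine ⟨f - Finsupp.single i 1, ?_⟩
  ext j
  by_cases hj : i = j
  · subst hj; simp; omega
  · simp [Finsupp.single_apply, hj]

lemma v_apply {n l d : ℕ} (hl2 : 2 ≤ l) (hln : l ≤ n - 1) (i : Fin n) :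
    vVec n l d i = if (i : ℕ) = l - 1 then 1 else if (i : ℕ) = n - 1 then d - 1 else 0 := by
  have : l - 1 ≠ n - 1 := by omega
  simp only [vVec, sing, Finsupp.add_apply, Finsupp.smul_apply, Finsupp.onFinset_apply]
  split_ifs <;> simp <;> omega

lemma u_apply {n l : ℕ} (a : ℕ → ℕ) (hl2 : 2 ≤ l) (i : Fin n) (hi : (i : ℕ) < l) :
    uVec n l a i = if (i : ℕ) = 0 then 1 else 0 := by
  simp only [uVec, sing, Finsupp.add_apply, Finsupp.finsetSum_apply, Finsupp.smul_apply,
    Finsupp.onFinset_apply]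
  rw [Finset.sum_eq_zero]
  · simp
  · intro j hj
    have := (Finset.mem_Ico.mp hj).1
    rw [if_neg (by omega)]
    simp

lemma seg_low {n l d : ℕ} {a : ℕ → ℕ} (hl2 : 2 ≤ l) (hln : l ≤ n - 1) {f : Mon n}
    (hf : f ∈ lexSeg n l d a) :
    deg f = d ∧ 1 ≤ lo l f ∧ ((∀ z : Fin n, (z : ℕ) = 0 → f z = 0) ∨ lo l f = 1) := by
  obtain ⟨h1, h2, h3⟩ := hf
  have hn : 0 < n := by omega
  refine ⟨h1, ?_, ?_⟩
  · rcases h2 with h2 | ⟨i, hi, hlt⟩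
    · have := le_lo l f ⟨l - 1, by omega⟩ (by simp; omega)
      rw [← h2, v_apply hl2 hln] at this
      simpa [← h2] using this
    · by_cases hil : (i : ℕ) < l
      · have := le_lo l f i hil
        omega
      · have := le_lo l f ⟨l - 1, by omega⟩ (by simp; omega)
        rw [← hi ⟨l - 1, by omega⟩ (by simp [Fin.lt_def]; omega), v_apply hl2 hln] at this
        simpa using this
  · have key : ∀ g : Mon n, (∀ j : Fin n, (j : ℕ) < l → g j = uVec n l a j) → lo l g = 1 := by
      intro g hg
      unfold lo
      rw [Finset.sum_eq_single ⟨0, hn⟩]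
      · rw [if_pos (by simp; omega), hg _ (by simp; omega), u_apply a hl2 _ (by simp; omega)]
        simp
      · intro b _ hb
        split_ifs with h
        · rw [hg _ h, u_apply a hl2 _ h, if_neg]
          intro h0
          exact hb (Fin.ext h0)
        · rfl
      · simp
    rcases h3 with h3 | ⟨i, hi, hlt⟩
    · right
      exact key f (fun j _ => by rw [h3])
    · by_cases hil : (i : ℕ) < l
      · left
        intro z hz
        rw [u_apply a hl2 _ hil] at hlt
        split_ifs at hlt with h0
        · have : z = i := Fin.ext (by omega)
          rw [this]; omega
        · omega
      · right
        exact key f (fun j hj => hi j (by rw [Fin.lt_def]; omega))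

lemma seg_of {n l d : ℕ} {a : ℕ → ℕ} (hl2 : 2 ≤ l) (hln : l ≤ n - 1) (hd : 2 ≤ d) {f : Mon n}
    (h1 : deg f = d) (h2 : 1 ≤ lo l f) (h3 : ∀ z : Fin n, (z : ℕ) = 0 → f z = 0) :
    f ∈ lexSeg n l d a := by
  have hn : 0 < n := by omega
  refine ⟨h1, ?_, Or.inr ⟨⟨0, hn⟩, ?_, ?_⟩⟩
  · by_cases hfv : vVec n l d = f
    · exact Or.inl hfv
    right
    have hne : ∃ i : Fin n, vVec n l d i ≠ f i := by
      by_contra hc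
      push Not at hc
      exact hfv (Finsupp.ext hc)
    have hS : (Finset.univ.filter fun i : Fin n => vVec n l d i ≠ f i).Nonempty := by
      obtain ⟨i, hi⟩ := hne
      exact ⟨i, by simp [hi]⟩
    obtain ⟨i, hi, hmin⟩ := Finset.exists_min_image _ id hS
    have hi' : vVec n l d i ≠ f i := by simpa using hi
    have hag : ∀ j : Fin n, j < i → vVec n l d j = f j := by
      intro j hj
      by_contra hc
      have := hmin j (by simp [hc])
      exact absurd hj (not_lt.mpr this)
    refine ⟨i, hag, ?_⟩
    by_contra hge
    have hlt : f i < vVec n l d i := by omega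
    rw [v_apply hl2 hln] at hlt
    split_ifs at hlt with c1 c2
    · obtain ⟨p, hp, hp0⟩ := exists_of_lo l f h2
      by_cases hpi : p = i
      · subst hpi; omega
      · have hpi' : (p : ℕ) ≠ i := fun h => hpi (Fin.ext h)
        have := hag p (by rw [Fin.lt_def]; omega)
        rw [v_apply hl2 hln] at this
        rw [if_neg (by omega), if_neg (by omega)] at this
        omega
    · have hdv : deg (vVec n l d) = d := by
        have e1 : vVec n l d = Finsupp.single ⟨l - 1, by omega⟩ 1
            + (d - 1) • Finsupp.single (⟨n - 1, by omega⟩ : Fin n) 1 := by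
          unfold vVec
          rw [← sing_eq, ← sing_eq]
        have e2 : ∀ (c : ℕ) (j : Fin n), deg (c • Finsupp.single j 1 : Mon n) = c := by
          intro c j
          rw [deg_eq, Finset.sum_eq_single j]
          · simp
          · intro b _ hb
            simp [hb.symm]
          · simp
        rw [e1, deg_add, deg_single, e2]
        omega
      have : deg f < deg (vVec n l d) := by
        rw [deg_eq, deg_eq]
        refine Finset.sum_lt_sum (fun j _ => ?_) ⟨i, Finset.mem_univ _, by omega⟩
        by_cases hji : j = i
        · subst hji; omega
        · have hji' : (j : ℕ) ≠ i := fun h => hji (Fin.ext h)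
          exact (hag j (by rw [Fin.lt_def]; have := j.2; omega)).ge
      omega
    · omega
  · intro j hj
    simp [Fin.lt_def] at hj
  · rw [h3 _ rfl, u_apply a hl2 _ (by simp; omega)]
    simp

lemma lexLT_trans {n : ℕ} {p q r : Mon n} (h1 : lexLT p q) (h2 : lexLT q r) : lexLT p r := by
  obtain ⟨i, hi, hi'⟩ := h1
  obtain ⟨j, hj, hj'⟩ := h2
  rcases lt_trichotomy i j with h | h | h
  · exact ⟨i, fun x hx => (hi x hx).trans (hj x (hx.trans h)), by rw [← hj i h]; exact hi'⟩
  · subst h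
    exact ⟨i, fun x hx => (hi x hx).trans (hj x hx), hi'.trans hj'⟩
  · exact ⟨j, fun x hx => (hi x (hx.trans h)).trans (hj x hx), by rw [hi j h]; exact hj'⟩

lemma seg_swap {n l d : ℕ} {a : ℕ → ℕ} (hl2 : 2 ≤ l) (hln : l ≤ n - 1) (hd : 2 ≤ d) {r : Mon n}
    {i t : Fin n} (hi : l ≤ (i : ℕ)) (hit : i < t)
    (hf : r + Finsupp.single i 1 ∈ lexSeg n l d a) :
    r + Finsupp.single t 1 ∈ lexSeg n l d a := by
  have hn : 0 < n := by omega
  have ht : l ≤ (t : ℕ) := by rw [Fin.lt_def] at hit; omega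
  obtain ⟨h1, h2, h3⟩ := seg_low hl2 hln hf
  rw [deg_add, deg_single] at h1
  rw [lo_add, lo_single, if_neg (by omega)] at h2
  by_cases hz : ∀ z : Fin n, (z : ℕ) = 0 → r z = 0
  · refine seg_of hl2 hln hd (by rw [deg_add, deg_single]; exact h1) (by rw [lo_add]; omega) ?_
    intro z hz0
    have : t ≠ z := fun h => by subst h; omega
    simp [hz z hz0, Finsupp.single_apply, this]
  · push Not at hz
    obtain ⟨z, hz0, hz1⟩ := hz
    refine ⟨by rw [deg_add, deg_single]; exact h1, Or.inr ⟨z, ?_, ?_⟩, ?_⟩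
    · intro j hj
      rw [Fin.lt_def] at hj
      omega
    · rw [v_apply hl2 hln, if_neg (by omega), if_neg (by omega)]
      simp; omega
    · have hlt : lexLT (r + Finsupp.single t 1) (r + Finsupp.single i 1) := by
        refine ⟨i, fun j hj => ?_, ?_⟩
        · have e1 : t ≠ j := (hj.trans hit).ne'
          have e2 : i ≠ j := hj.ne'
          simp [Finsupp.single_apply, e1, e2]
        · have e1 : t ≠ i := hit.ne'
          simp [Finsupp.single_apply, e1]
      right
      rcases hf.2.2 with h | h
      · rw [← h]; exact hlt
      · exact lexLT_trans hlt h

/-- sums of `k` elements of the lexsegment -/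
def P (n l d : ℕ) (a : ℕ → ℕ) (k : ℕ) : Set (Mon n) :=
  {m | ∃ M : Multiset (Mon n), M.card = k ∧ (∀ f ∈ M, f ∈ lexSeg n l d a) ∧ M.sum = m}

lemma pow_eq (n l d : ℕ) (a : ℕ → ℕ) (K : Type*) [Field K] (k : ℕ) :
    lexIdeal n l d a K ^ k = Ideal.span ((fun w => monomial w (1 : K)) '' P n l d a k) := by
  induction k with
  | zero =>
    rw [pow_zero, Ideal.one_eq_top, eq_comm, Ideal.eq_top_iff_one]
    refine Ideal.subset_span ⟨0, ⟨0, by simp, by simp, by simp⟩, ?_⟩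
    simp
  | succ k ih =>
    rw [pow_succ, ih, lexIdeal, Ideal.span_mul_span']
    congr 1
    ext x
    simp only [Set.mem_mul, Set.mem_image]
    constructor
    · rintro ⟨_, ⟨p, ⟨M, h1, h2, h3⟩, rfl⟩, _, ⟨f, hf, rfl⟩, rfl⟩
      refine ⟨p + f, ⟨f ::ₘ M, by simp [h1], ?_, by simp [h3, add_comm]⟩, by simp [monomial_mul]⟩
      intro g hg
      rcases Multiset.mem_cons.mp hg with rfl | hg
      · exact hf
      · exact h2 g hg
    · rintro ⟨p, ⟨M, h1, h2, h3⟩, rfl⟩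
      obtain ⟨f, hf⟩ : ∃ f, f ∈ M := Multiset.card_pos_iff_exists_mem.mp (by omega)
      obtain ⟨M', rfl⟩ := Multiset.exists_cons_of_mem hf
      refine ⟨_, ⟨M'.sum, ⟨M', by simpa using h1, fun g hg => h2 g (by simp [hg]), rfl⟩, rfl⟩,
        _, ⟨f, h2 f hf, rfl⟩, ?_⟩
      rw [← h3]
      simp [monomial_mul, add_comm]

lemma P_deg {n l d : ℕ} {a : ℕ → ℕ} {k : ℕ} {m : Mon n} (hm : m ∈ P n l d a k) :
    deg m = k * d := by
  obtain ⟨M, rfl, h2, rfl⟩ := hm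
  induction M using Multiset.induction_on with
  | empty => simp [deg]
  | cons f M ih =>
    rw [Multiset.sum_cons, deg_add, ih (fun g hg => h2 g (by simp [hg])), (h2 f (by simp)).1]
    simp; ring

lemma P_lo {n l d : ℕ} {a : ℕ → ℕ} (hl2 : 2 ≤ l) (hln : l ≤ n - 1)
    {k : ℕ} {m : Mon n} (hm : m ∈ P n l d a k) : k ≤ lo l m := by
  obtain ⟨M, rfl, h2, rfl⟩ := hm
  induction M using Multiset.induction_on with
  | empty => simp
  | cons f M ih =>
    have := ih (fun g hg => h2 g (by simp [hg]))
    have := (seg_low hl2 hln (h2 f (by simp))).2.1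
    rw [Multiset.sum_cons, lo_add, Multiset.card_cons]
    omega

lemma exists_factor {n : ℕ} (M : Multiset (Mon n)) (i : Fin n) (h : M.sum i ≠ 0) :
    ∃ f ∈ M, f i ≠ 0 := by
  induction M using Multiset.induction_on with
  | empty => simp at h
  | cons f M ih =>
    by_cases hf : f i = 0
    · obtain ⟨g, hg, hg'⟩ := ih (by simpa [hf] using h)
      exact ⟨g, by simp [hg], hg'⟩
    · exact ⟨f, by simp, hf⟩

lemma exists_big {n l : ℕ} (M : Multiset (Mon n)) (h : M.card < lo l M.sum) :
    ∃ f ∈ M, 2 ≤ lo l f := by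
  induction M using Multiset.induction_on with
  | empty => simp [lo] at h
  | cons f M ih =>
    by_cases hf : 2 ≤ lo l f
    · exact ⟨f, by simp, hf⟩
    · rw [Multiset.sum_cons, lo_add, Multiset.card_cons] at h
      obtain ⟨g, hg, hg'⟩ := ih (by omega)
      exact ⟨g, by simp [hg], hg'⟩

lemma P_add {n l d : ℕ} {a : ℕ → ℕ} {M : Multiset (Mon n)} {f : Mon n}
    (h : ∀ g ∈ M, g ∈ lexSeg n l d a) (hf : f ∈ lexSeg n l d a) :
    f + M.sum ∈ P n l d a (M.card + 1) := by
  refine ⟨f ::ₘ M, by simp, ?_, by simp⟩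
  intro g hg
  rcases Multiset.mem_cons.mp hg with rfl | hg
  · exact hf
  · exact h g hg

lemma lemB {n l d : ℕ} {a : ℕ → ℕ} (hl2 : 2 ≤ l) (hln : l ≤ n - 1) (hd : 2 ≤ d)
    {k : ℕ} {m : Mon n} (hm : m ∈ P n l d a k) {i t : Fin n} (hi : l ≤ (i : ℕ)) (hit : i < t)
    (hmi : m i ≠ 0) :
    ∃ z ∈ P n l d a k, z + Finsupp.single i 1 = m + Finsupp.single t 1 := by
  obtain ⟨M, rfl, h2, rfl⟩ := hm
  obtain ⟨f, hf, hfi⟩ := exists_factor M i hmi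
  obtain ⟨M, rfl⟩ := Multiset.exists_cons_of_mem hf
  obtain ⟨r, rfl⟩ := exists_split f i hfi
  have hs := seg_swap hl2 hln hd hi hit (h2 _ hf)
  refine ⟨_, by simpa using P_add (fun g hg => h2 g (by simp [hg])) hs, ?_⟩
  rw [Multiset.sum_cons]
  abel

lemma split_zero {n l : ℕ} {r : Mon n} {i : Fin n} (hil : (i : ℕ) < l) (hl : 0 < l)
    (h : (∀ z : Fin n, (z : ℕ) = 0 → (r + Finsupp.single i 1 : Mon n) z = 0) ∨
      lo l (r + Finsupp.single i 1) = 1) : ∀ z : Fin n, (z : ℕ) = 0 → r z = 0 := by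
  intro z hz
  rcases h with h | h
  · have := h z hz
    simp at this
    exact this.1
  · rw [lo_add, lo_single, if_pos hil] at h
    have := le_lo l r z (by omega)
    omega

lemma lemA {n l d : ℕ} {a : ℕ → ℕ} (hl2 : 2 ≤ l) (hln : l ≤ n - 1) (hd : 2 ≤ d)
    {k : ℕ} {m : Mon n} (hm : m ∈ P n l d a k) {i t : Fin n} (hi : (i : ℕ) < l) (hit : i < t)
    (hmi : m i ≠ 0) (h : (t : ℕ) < l ∨ k < lo l m) :
    ∃ z ∈ P n l d a k, z + Finsupp.single i 1 = m + Finsupp.single t 1 := by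
  obtain ⟨M, rfl, h2, rfl⟩ := hm
  obtain ⟨f, hf, hfi⟩ := exists_factor M i hmi
  obtain ⟨M, rfl⟩ := Multiset.exists_cons_of_mem hf
  obtain ⟨r, rfl⟩ := exists_split f i hfi
  obtain ⟨q1, q2, q3⟩ := seg_low hl2 hln (h2 _ (by simp : r + Finsupp.single i 1 ∈ _))
  have q4 := split_zero hi (by omega) q3
  have ht0 : ∀ z : Fin n, (z : ℕ) = 0 → t ≠ z := by
    rintro z hz rfl
    rw [Fin.lt_def] at hit
    omega
  rw [deg_add, deg_single] at q1
  by_cases hc : (t : ℕ) < l ∨ 2 ≤ lo l (r + Finsupp.single i 1)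
  · have hs : r + Finsupp.single t 1 ∈ lexSeg n l d a := by
      refine seg_of hl2 hln hd (by rw [deg_add, deg_single]; exact q1) ?_ ?_
      · rw [lo_add, lo_single]
        rw [lo_add, lo_single, if_pos hi] at hc
        split_ifs <;> omega
      · intro z hz
        simp [q4 z hz, Finsupp.single_apply, ht0 z hz]
    refine ⟨_, by simpa using P_add (fun g hg => h2 g (by simp [hg])) hs, ?_⟩
    rw [Multiset.sum_cons]
    abel
  · push Not at hc
    have h' : M.card < lo l M.sum := by
      rw [Multiset.sum_cons, lo_add, Multiset.card_cons] at h
      omega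
    obtain ⟨g, hg, hg2⟩ := exists_big M h'
    obtain ⟨M, rfl⟩ := Multiset.exists_cons_of_mem hg
    obtain ⟨q, hq, hq0⟩ := exists_of_lo l g (by omega)
    obtain ⟨c, rfl⟩ := exists_split g q hq0
    obtain ⟨w1, w2, w3⟩ := seg_low hl2 hln (h2 _ (by simp : c + Finsupp.single q 1 ∈ _))
    have w4 := split_zero hq (by omega) w3
    have hqz : ∀ z : Fin n, (z : ℕ) = 0 → q ≠ z := by
      rintro z hz rfl
      rcases w3 with w3 | w3
      · exact hq0 (w3 _ hz)
      · omega
    rw [deg_add, deg_single] at w1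
    rw [lo_add, lo_single, if_pos hq] at hg2
    have hs1 : r + Finsupp.single q 1 ∈ lexSeg n l d a := by
      refine seg_of hl2 hln hd (by rw [deg_add, deg_single]; exact q1) ?_ ?_
      · rw [lo_add, lo_single, if_pos hq]
        omega
      · intro z hz
        simp [q4 z hz, Finsupp.single_apply, hqz z hz]
    have hs2 : c + Finsupp.single t 1 ∈ lexSeg n l d a := by
      refine seg_of hl2 hln hd (by rw [deg_add, deg_single]; exact w1) ?_ ?_
      · rw [lo_add]
        omega
      · intro z hz
        simp [w4 z hz, Finsupp.single_apply, ht0 z hz]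
    refine ⟨(r + Finsupp.single q 1) + ((c + Finsupp.single t 1) + M.sum),
      ⟨(r + Finsupp.single q 1) ::ₘ (c + Finsupp.single t 1) ::ₘ M, by simp, ?_, by simp⟩, ?_⟩
    · intro g hg
      simp only [Multiset.mem_cons] at hg
      rcases hg with rfl | rfl | hg
      · exact hs1
      · exact hs2
      · exact h2 g (by simp [hg])
    · simp only [Multiset.sum_cons]
      abel

lemma mem_span_iff {n : ℕ} (K : Type*) [Field K] (S : Set (Mon n)) (m : Mon n) :
    monomial m (1 : K) ∈ Ideal.span ((fun w => monomial w (1 : K)) '' S) ↔ ∃ p ∈ S, p ≤ m := by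
  rw [mem_ideal_span_monomial_image]
  classical
  simp [support_monomial]

lemma deg_mono {n : ℕ} {p q : Mon n} (h : p ≤ q) : deg p ≤ deg q := by
  rw [deg_eq, deg_eq]
  exact Finset.sum_le_sum fun i _ => h i

lemma minGens_eq (n l d : ℕ) (a : ℕ → ℕ) (K : Type*) [Field K] (k : ℕ) :
    minGens K (lexIdeal n l d a K ^ k) = P n l d a k := by
  ext m
  rw [pow_eq]
  simp only [minGens, Set.mem_ofPred_eq, mem_span_iff]
  constructor
  · rintro ⟨⟨p, hp, hpm⟩, h⟩
    by_cases hpe : p = m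
    · rwa [← hpe]
    exfalso
    obtain ⟨i, hi⟩ : ∃ i, p i ≠ m i := by
      by_contra hc
      push Not at hc
      exact hpe (Finsupp.ext hc)
    have hlt : p i < m i := lt_of_le_of_ne (hpm i) hi
    refine h i (by simp; omega) ⟨p, hp, fun j => ?_⟩
    by_cases hj : i = j
    · subst hj; simp; omega
    · simpa [Finsupp.single_apply, hj] using hpm j
  · intro hm
    refine ⟨⟨m, hm, le_rfl⟩, ?_⟩
    rintro i hi ⟨p, hp, hpm⟩
    obtain ⟨r, rfl⟩ := exists_split m i (by simpa using hi)
    have := deg_mono hpm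
    rw [add_tsub_cancel_right] at this
    have h1 := P_deg hp
    have h2 := P_deg hm
    rw [deg_add, deg_single] at h2
    omega

lemma mem_set_iff (n l d : ℕ) (a : ℕ → ℕ) (K : Type*) [Field K] (k : ℕ) (m : Mon n)
    (hm : deg m = k * d) (t : ℕ) :
    t ∈ setOfGen K (lexIdeal n l d a K ^ k) m ↔ ∃ j : Fin n, (j : ℕ) = t ∧ ∃ i : Fin n, i < j ∧
      ∃ z ∈ P n l d a k, z + Finsupp.single i 1 = m + Finsupp.single j 1 := by
  simp only [setOfGen, idealBelow, minGens_eq, Set.mem_ofPred_eq, mem_span_iff]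
  constructor
  · rintro ⟨ht, z, ⟨hz, s, hs1, hs2⟩, hle⟩
    refine ⟨⟨t, ht⟩, rfl, ?_⟩
    have e := sing_eq (⟨t, ht⟩ : Fin n)
    simp only at e
    rw [e] at hle
    generalize (⟨t, ht⟩ : Fin n) = j at hle
    obtain ⟨c, hc⟩ := exists_add_of_le hle
    have hdc : deg c = 1 := by
      have := congrArg deg hc
      rw [deg_add, deg_add, deg_single, P_deg hz, hm] at this
      omega
    have hc0 : ∃ i, c i ≠ 0 := by
      by_contra hcc
      push Not at hcc
      rw [deg_eq, Finset.sum_eq_zero (fun i _ => hcc i)] at hdc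
      omega
    obtain ⟨i, hi⟩ := hc0
    obtain ⟨r, rfl⟩ := exists_split c i hi
    have hr : r = 0 := by
      rw [deg_add, deg_single] at hdc
      have h0 : deg r = 0 := by omega
      rw [deg_eq, Finset.sum_eq_zero_iff] at h0
      ext x
      exact h0 x (Finset.mem_univ _)
    subst hr
    rw [zero_add] at hc
    refine ⟨i, ?_, z, hz, hc.symm⟩
    have hx : ∀ x, m x + (if j = x then 1 else 0) = z x + (if i = x then 1 else 0) := by
      intro x
      have := DFunLike.congr_fun hc x
      simpa [Finsupp.single_apply] using this
    by_contra hij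
    have hsj : j = s ∧ i ≠ s := by
      have := hx s
      split_ifs at this with u1 u2 u2
      · omega
      · exact ⟨u1, u2⟩
      · omega
      · omega
    obtain ⟨rfl, his⟩ := hsj
    have hji : j < i := lt_of_le_of_ne (not_lt.mp hij) his.symm
    have h1 := hx i
    rw [if_neg hji.ne, if_pos rfl, hs1 i hji] at h1
    omega
  · rintro ⟨j, rfl, i, hij, z, hz, h⟩
    refine ⟨j.2, z, ⟨hz, j, ?_, ?_⟩, ?_⟩
    · intro x hx
      have := DFunLike.congr_fun h x
      simpa [Finsupp.single_apply, hx.ne, (hij.trans hx).ne] using this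
    · have := DFunLike.congr_fun h j
      simp [Finsupp.single_apply, hij.ne] at this
      omega
    · rw [sing_eq, ← h]
      exact le_self_add

end S13

open S13 in
theorem stmt13 (n d l k : ℕ) (K : Type*) [Field K] (a : ℕ → ℕ)
    (hd : 2 ≤ d) (hl2 : 2 ≤ l) (hln : l ≤ n - 1)
    (hsum : ∑ j ∈ Finset.Ico l n, a j = d - 1) (hk : 1 ≤ k) :
    ∀ m ∈ minGens K ((lexIdeal n l d a K) ^ k),
      ∀ s ∈ setOfGen K ((lexIdeal n l d a K) ^ k) m,
        precLT l (k • vVec n l d) (m + sing n s - sing n (minIdx m)) →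
          setOfGen K ((lexIdeal n l d a K) ^ k) (m + sing n s - sing n (minIdx m)) ⊆
            setOfGen K ((lexIdeal n l d a K) ^ k) m := by
  intro m hm s hs hprec t ht
  have hmP := hm
  rw [minGens_eq] at hmP
  have hdm := P_deg hmP
  have hlm := P_lo hl2 hln hmP
  rw [mem_set_iff n l d a K k m hdm] at hs ⊢
  obtain ⟨s, rfl, i0, hi0, z0, hz0, e0⟩ := hs
  have hmi0 : m i0 ≠ 0 := by
    have := DFunLike.congr_fun e0 i0
    simp [Finsupp.single_apply, hi0.ne'] at this
    omega
  obtain ⟨hμn, hμ0⟩ : ∃ h : minIdx m < n, m ⟨minIdx m, h⟩ ≠ 0 :=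
    Nat.sInf_mem (s := {j : ℕ | ∃ h : j < n, m ⟨j, h⟩ ≠ 0}) ⟨i0, i0.2, hmi0⟩
  have hμle : ∀ j : Fin n, m j ≠ 0 → minIdx m ≤ j := fun j hj => Nat.sInf_le ⟨j.2, hj⟩
  obtain ⟨μ, hμ⟩ : ∃ μ : Fin n, (μ : ℕ) = minIdx m := ⟨⟨_, hμn⟩, rfl⟩
  have hμ0 : m μ ≠ 0 := by
    have : μ = ⟨minIdx m, hμn⟩ := Fin.ext hμ
    rwa [this]
  rw [← hμ] at hμle
  rw [← hμ, sing_eq, sing_eq] at ht hprec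
  obtain ⟨r, hr⟩ := exists_split m μ hμ0
  have hm' : m + Finsupp.single s 1 - Finsupp.single μ 1 = r + Finsupp.single s 1 := by
    rw [hr, add_right_comm, add_tsub_cancel_right]
  rw [hm'] at ht hprec
  rw [mem_set_iff n l d a K k _ (by rw [← hdm, hr, deg_add, deg_add, deg_single, deg_single])] at ht
  obtain ⟨t, rfl, i, hit, z, hz, e⟩ := ht
  refine ⟨t, rfl, ?_⟩
  have hv : lo l (k • vVec n l d) = k := by
    have e1 : ∀ c : ℕ, lo l (c • vVec n l d) = c * lo l (vVec n l d) := by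
      intro c
      induction c with
      | zero => simp [lo]
      | succ c ih => rw [succ_nsmul, lo_add, ih]; ring
    have e2 : lo l (vVec n l d) = 1 := by
      unfold lo
      rw [Finset.sum_eq_single ⟨l - 1, by omega⟩]
      · rw [v_apply hl2 hln]
        simp; omega
      · intro b _ hb
        have : (b : ℕ) ≠ l - 1 := fun h => hb (Fin.ext h)
        split_ifs with h
        · rw [v_apply hl2 hln, if_neg this, if_neg (by omega)]
        · rfl
      · simp
    rw [e1, e2, mul_one]
  have hlow : k ≤ lo l (r + Finsupp.single s 1) := by
    unfold precLT at hprec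
    rw [lowPart_eq, lowPart_eq, hv] at hprec
    omega
  have hμs : μ < s := by
    have := hμle i0 hmi0
    rw [Fin.lt_def] at hi0 ⊢
    omega
  have hi' : r i ≠ 0 ∨ s = i := by
    have := DFunLike.congr_fun e i
    simp [Finsupp.single_apply, hit.ne'] at this
    by_contra hc
    push Not at hc
    rw [if_neg hc.2] at this
    omega
  have hmr : ∀ j, r j ≠ 0 → m j ≠ 0 := by
    intro j hj
    rw [hr, Finsupp.add_apply]
    omega
  have hμi : μ ≤ i := by
    rcases hi' with h | rfl
    · exact hμle i (hmr i h)
    · exact hμs.le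
  have hμt : μ < t := lt_of_le_of_lt hμi hit
  obtain ⟨p, hp, hp0⟩ := exists_of_lo l m (by omega)
  have hμl : (μ : ℕ) < l := lt_of_le_of_lt (hμle p hp0) hp
  by_cases hcase : (t : ℕ) < l ∨ k < lo l m
  · exact ⟨μ, hμt, lemA hl2 hln hd hmP hμl hμt hμ0 hcase⟩
  · push Not at hcase
    obtain ⟨htl, hmk⟩ := hcase
    have hlz := P_lo hl2 hln hz
    have elo := congrArg (lo l) e
    rw [lo_add, lo_add, lo_single, lo_single, if_neg (by omega : ¬ (t : ℕ) < l)] at elo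
    have hlm' : lo l m = lo l r + 1 := by
      rw [hr, lo_add, lo_single, if_pos hμl]
    rw [lo_add, lo_single] at hlow elo
    have hsl : (s : ℕ) < l := by
      by_contra hc
      rw [if_neg hc] at hlow
      omega
    rw [if_pos hsl] at hlow elo
    have hil : l ≤ (i : ℕ) := by
      by_contra hc
      rw [if_pos (by omega)] at elo
      omega
    have hmi : m i ≠ 0 := by
      rcases hi' with h | rfl
      · exact hmr i h
      · omega
    exact ⟨i, hit, lemB hl2 hln hd hmP hil hit hmi⟩
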